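/- Let t, r be integers with t ≥ r + 2 ≥ 5 and m = C(t,r) − 3. Then among all r-uniform hypergraphs on t vertices with m edges, the one formed by taking the first m sets in the colex ordering of ℕ^(r) has the largest Lagrangian. Explicitly, λ(G1) ≤ λ(G2) where G2 = [t]^(r) minus the three r-sets {(t−r+1)···t, (t−r)(t−r+2)···t, (t−r−1)(t−r+2)···t} and G1 = [t]^(r) minus {(t−r+1)···t, (t−r)(t−r+2)···t, (t−r)(t−r+1)(t−r+3)···t}. -/

import Mathlib

open Finset

/-- The evaluation of the Lagrangian polynomial of a hypergraph on ℕ at a weighting `x`. -/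
noncomputable def lagEvalN (E : Finset (Finset ℕ)) (x : ℕ → ℝ) : ℝ :=
  ∑ e ∈ E, ∏ i ∈ e, x i

/-- A legal weighting on ℕ: nonnegative, finitely supported, summing to 1. -/
def IsLegalN (x : ℕ → ℝ) : Prop :=
  (∀ i, 0 ≤ x i) ∧ ∃ s : Finset ℕ, (∀ i ∉ s, x i = 0) ∧ ∑ i ∈ s, x i = 1

/-- The Lagrangian of a hypergraph on ℕ. -/
noncomputable def lagrangianN (E : Finset (Finset ℕ)) : ℝ :=
  sSup {v | ∃ x, IsLegalN x ∧ lagEvalN E x = v}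

/-- Polynomial in four variables with elementary symmetric coefficients. -/
noncomputable def fourPoly (P0 P1 P2 P3 P4 a b c d : ℝ) : ℝ :=
  P0 + (a + b + c + d) * P1 + (a*b + a*c + a*d + b*c + b*d + c*d) * P2
    + (a*b*c + a*b*d + a*c*d + b*c*d) * P3 + a*b*c*d * P4

lemma amgm3 (b c d : ℝ) (hb : 0 ≤ b) (hc : 0 ≤ c) (hd : 0 ≤ d) :
    b*c*d ≤ ((b+c+d)/3)^3 := by
  nlinarith [mul_nonneg hb (sq_nonneg (c-d)), mul_nonneg hc (sq_nonneg (b-d)),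
    mul_nonneg hd (sq_nonneg (b-c)), mul_nonneg (add_nonneg (add_nonneg hb hc) hd)
      (add_nonneg (add_nonneg (sq_nonneg (b-c)) (sq_nonneg (b-d))) (sq_nonneg (c-d)))]

lemma four_step {P0 P1 P2 P3 P4 Q a b c d : ℝ} (h3 : 0 ≤ P3) (h4 : 0 ≤ P4)
    (hQ : 0 ≤ Q) (hP : Q ≤ P2) (ha : 0 ≤ a) (hb : 0 ≤ b) (hc : 0 ≤ c) (hd : 0 ≤ d) :
    ∃ a' b' c' d' : ℝ, 0 ≤ a' ∧ 0 ≤ b' ∧ 0 ≤ c' ∧ 0 ≤ d' ∧ a' + b' + c' + d' = a + b + c + d ∧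
      fourPoly P0 P1 P2 P3 P4 a b c d - Q * (b*c + b*d + c*d) ≤
        fourPoly P0 P1 P2 P3 P4 a' b' c' d' - Q * ((a' + b' + c') * d') := by
  set s := a + b + c + d with hs
  let f : ℝ → ℝ := fun u => fourPoly P0 P1 P2 P3 P4 (s - 3*u) u u u - Q * (3 * u^2)
  have hf : ∀ u, HasDerivAt f (3 * ((s - 4*u) * (P2 + 2*u*P3 + u^2*P4) - 2*u*Q)) u := by
    intro u
    have hpoly : f = fun u => P0 + s * P1 + (3*s*u - 6*u^2) * P2 + (3*s*u^2 - 8*u^3) * P3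
        + (s*u^3 - 3*u^4) * P4 - Q*(3*u^2) := by
      funext u; simp only [f, fourPoly]; ring
    rw [hpoly]
    have h1 := hasDerivAt_id u
    have e2 := (hasDerivAt_pow 2 u)
    have e3 := (hasDerivAt_pow 3 u)
    have e4 := (hasDerivAt_pow 4 u)
    have := ((((((h1.const_mul (3*s)).sub (e2.const_mul 6)).mul_const P2).const_add
      (P0 + s*P1)).add (((e2.const_mul (3*s)).sub (e3.const_mul 8)).mul_const P3)).add
      (((e3.const_mul s).sub (e4.const_mul 3)).mul_const P4)).sub ((e2.const_mul 3).const_mul Q)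
    refine HasDerivAt.congr_deriv (f' := _) this ?_
    norm_num
    ring
  have hs0 : 0 ≤ s := by positivity
  obtain ⟨p, hp, hmax⟩ := isCompact_Icc.exists_isMaxOn (s := Set.Icc (0:ℝ) (s/3))
    ⟨0, by constructor <;> linarith⟩ (fun u _ => (hf u).continuousAt.continuousWithinAt : ContinuousOn f _)
  obtain ⟨hp0, hp1⟩ := hp
  have hle : fourPoly P0 P1 P2 P3 P4 a b c d - Q * (b*c + b*d + c*d) ≤ f p := by
    refine le_trans ?_ (hmax (show (b+c+d)/3 ∈ Set.Icc (0:ℝ) (s/3) by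
      constructor
      · positivity
      · linarith))
    have k1 : 0 ≤ (P2 + a*P3 - Q) := by nlinarith [mul_nonneg ha h3]
    have k2 : 0 ≤ (P3 + a*P4) := by positivity
    have k3 : b*c + b*d + c*d ≤ 3*((b+c+d)/3)^2 := by
      nlinarith [sq_nonneg (b-c), sq_nonneg (b-d), sq_nonneg (c-d)]
    have k4 := amgm3 b c d hb hc hd
    have e : s - 3*((b+c+d)/3) = a := by rw [hs]; ring
    simp only [f, e, fourPoly]
    nlinarith [mul_le_mul_of_nonneg_left k3 k1, mul_le_mul_of_nonneg_left k4 k2]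
  clear_value s
  set z := s - 3*p with hz
  have hz0 : 0 ≤ z := by linarith
  have hfp : f p = fourPoly P0 P1 P2 P3 P4 z p p p - Q * (3*p^2) := rfl
  -- the easy case
  by_cases hcase : Q * (p * (z - p)) ≤ 0
  · refine ⟨z, p, p, p, hz0, hp0, hp0, hp0, by rw [hz]; ring, hle.trans ?_⟩
    rw [hfp]; nlinarith
  push Not at hcase
  have hQp : 0 < Q := lt_of_le_of_ne hQ (by rintro rfl; simp at hcase)
  have hpp : 0 < p := lt_of_le_of_ne hp0 (by intro h; rw [← h] at hcase; simp at hcase)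
  have hzp : 0 < z - p := by
    by_contra h
    push Not at h
    nlinarith [mul_nonneg hQ hp0]
  have hloc : IsLocalMax f p := by
    refine hmax.isLocalMax (Icc_mem_nhds hpp ?_)
    linarith
  have hd0 := hloc.hasDerivAt_eq_zero (hf p)
  obtain ⟨α, hα⟩ : ∃ α, α = (z - p)/2 := ⟨_, rfl⟩
  have hα0 : 0 < α := by rw [hα]; linarith
  have hzα : z = p + 2*α := by rw [hα]; ring
  have hE : α * (P2 + 2*p*P3 + p^2*P4) = p * Q := by
    have : s - 4*p = 2*α := by linarith
    rw [this] at hd0; linarith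
  have hαp : α ≤ p := by
    by_contra h
    push Not at h
    nlinarith [mul_nonneg hp0 h3, mul_nonneg (sq_nonneg p) h4, mul_pos (sub_pos.2 h) hQp,
      mul_nonneg hα0.le (mul_nonneg hp0 h3), mul_nonneg hα0.le (mul_nonneg (sq_nonneg p) h4),
      mul_nonneg hα0.le (sub_nonneg.2 hP)]
  refine ⟨p+α, p+α, p+α, p-α, by linarith, by linarith, by linarith, by linarith, by linarith,
    hle.trans ?_⟩
  rw [hfp, hzα, ← sub_nonneg]
  have key : 0 ≤ 3*α^2*Q - 2*α^3*(P3 + p*P4) - α^4*P4 := by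
    have : 0 ≤ p * (3*α^2*Q - 2*α^3*(P3 + p*P4) - α^4*P4) := by
      have e : p * (3*α^2*Q - 2*α^3*(P3 + p*P4) - α^4*P4)
        = 3*α^3*(P2-Q) + 3*α^3*Q + α^3*(4*p*P3) + α^3*p*P4*(p-α) := by
        linear_combination (-3*α^2)*hE
      rw [e]
      have := sub_nonneg.2 hP
      have := sub_nonneg.2 hαp
      positivity
    exact nonneg_of_mul_nonneg_right this hpp
  refine key.trans (le_of_eq ?_)
  simp only [fourPoly]; ring

lemma lag_insert (V : Finset ℕ) (v : ℕ) (hv : v ∉ V) (k : ℕ) (x : ℕ → ℝ) :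
    lagEvalN ((insert v V).powersetCard (k+1)) x
      = lagEvalN (V.powersetCard (k+1)) x + x v * lagEvalN (V.powersetCard k) x := by
  unfold lagEvalN
  rw [Finset.powersetCard_succ_insert hv, Finset.sum_union, Finset.sum_image, Finset.mul_sum]
  · congr 1
    apply Finset.sum_congr rfl
    intro e he
    rw [Finset.prod_insert]
    intro h; exact hv ((Finset.mem_powersetCard.1 he).1 h)
  · intro e he e' he' h
    have h1 : v ∉ e := fun h => hv ((Finset.mem_powersetCard.1 he).1 h)
    have h2 : v ∉ e' := fun h => hv ((Finset.mem_powersetCard.1 he').1 h)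
    rw [← Finset.erase_insert h1, ← Finset.erase_insert h2, h]
  · rw [Finset.disjoint_left]
    intro e he he'
    obtain ⟨e', _, rfl⟩ := Finset.mem_image.1 he'
    exact hv ((Finset.mem_powersetCard.1 he).1 (Finset.mem_insert_self _ _))

/-- lower elementary symmetric function with shifted index -/
noncomputable def lagPred (W : Finset ℕ) (k : ℕ) (x : ℕ → ℝ) : ℝ :=
  match k with
  | 0 => 0
  | k+1 => lagEvalN (W.powersetCard k) x

lemma lag_insert' (V : Finset ℕ) (v : ℕ) (hv : v ∉ V) (k : ℕ) (x : ℕ → ℝ) :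
    lagEvalN ((insert v V).powersetCard k) x
      = lagEvalN (V.powersetCard k) x + x v * lagPred V k x := by
  cases k with
  | zero => simp [lagPred]
  | succ k => exact lag_insert V v hv k x

lemma lagEval_nonneg (E : Finset (Finset ℕ)) (x : ℕ → ℝ) (hx : ∀ i, 0 ≤ x i) :
    0 ≤ lagEvalN E x := Finset.sum_nonneg fun _ _ => Finset.prod_nonneg fun _ _ => hx _

lemma lagPred_nonneg (W : Finset ℕ) (k : ℕ) (x : ℕ → ℝ) (hx : ∀ i, 0 ≤ x i) :
    0 ≤ lagPred W k x := by
  cases k with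
  | zero => exact le_rfl
  | succ k => exact lagEval_nonneg _ _ hx

lemma lagEval_congr (W : Finset ℕ) (k : ℕ) (x y : ℕ → ℝ) (h : ∀ i ∈ W, x i = y i) :
    lagEvalN (W.powersetCard k) x = lagEvalN (W.powersetCard k) y := by
  apply Finset.sum_congr rfl
  intro e he
  exact Finset.prod_congr rfl fun i hi => h i ((Finset.mem_powersetCard.1 he).1 hi)

lemma lagPred_congr (W : Finset ℕ) (k : ℕ) (x y : ℕ → ℝ) (h : ∀ i ∈ W, x i = y i) :
    lagPred W k x = lagPred W k y := by
  cases k with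
  | zero => rfl
  | succ k => exact lagEval_congr W k x y h

lemma lag_four (W : Finset ℕ) (a b c d : ℕ) (ha : a ∉ W) (hb : b ∉ insert a W)
    (hc : c ∉ insert b (insert a W)) (hd : d ∉ insert c (insert b (insert a W)))
    (k : ℕ) (x : ℕ → ℝ) :
    lagEvalN ((insert d (insert c (insert b (insert a W)))).powersetCard (k+3)) x =
      fourPoly (lagEvalN (W.powersetCard (k+3)) x) (lagEvalN (W.powersetCard (k+2)) x)
        (lagEvalN (W.powersetCard (k+1)) x) (lagEvalN (W.powersetCard k) x) (lagPred W k x)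
        (x a) (x b) (x c) (x d) := by
  simp only [lag_insert _ _ hd, lag_insert _ _ hc, lag_insert _ _ hb, lag_insert _ _ ha,
    lag_insert' _ _ ha]
  unfold fourPoly
  ring

lemma lag_sdiff (K M : Finset (Finset ℕ)) (h : M ⊆ K) (x : ℕ → ℝ) :
    lagEvalN (K \ M) x = lagEvalN K x - lagEvalN M x := by
  unfold lagEvalN
  rw [← Finset.sum_sdiff h]; ring

/-- The legality of weightings only depends on the sum over a finite set. -/
lemma legal_of_modify {x y : ℕ → ℝ} (T : Finset ℕ) (hx : IsLegalN x) (hy : ∀ i, 0 ≤ y i)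
    (hout : ∀ i ∉ T, y i = x i) (hsum : ∑ i ∈ T, y i = ∑ i ∈ T, x i) : IsLegalN y := by
  obtain ⟨_, s, hs0, hs1⟩ := hx
  refine ⟨hy, s ∪ T, ?_, ?_⟩
  · intro i hi
    simp only [Finset.mem_union, not_or] at hi
    rw [hout i hi.2, hs0 i hi.1]
  · have h1 : ∑ i ∈ s ∪ T, x i = 1 := by
      rw [← hs1]; symm
      apply Finset.sum_subset Finset.subset_union_left
      intro i _ hi; exact hs0 i hi
    rw [← h1, ← Finset.sum_sdiff (Finset.subset_union_right : T ⊆ s ∪ T),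
      ← Finset.sum_sdiff (Finset.subset_union_right : T ⊆ s ∪ T), hsum]
    congr 1
    apply Finset.sum_congr rfl
    intro i hi
    exact hout i (Finset.mem_sdiff.1 hi).2

lemma legal_le_one {x : ℕ → ℝ} (hx : IsLegalN x) (i : ℕ) : x i ≤ 1 := by
  obtain ⟨h0, s, hs0, hs1⟩ := hx
  by_cases hi : i ∈ s
  · rw [← hs1]; exact Finset.single_le_sum (fun j _ => h0 j) hi
  · rw [hs0 i hi]; exact zero_le_one

lemma lagrangian_le_of (E F : Finset (Finset ℕ))
    (h : ∀ x, IsLegalN x → ∃ y, IsLegalN y ∧ lagEvalN E x ≤ lagEvalN F y) :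
    lagrangianN E ≤ lagrangianN F := by
  apply csSup_le
  · refine ⟨_, fun i => if i = 0 then 1 else 0, ⟨fun i => by dsimp; split_ifs <;> norm_num, {0}, ?_, ?_⟩, rfl⟩
    · intro i hi; simpa using hi
    · simp
  · rintro v ⟨x, hx, rfl⟩
    obtain ⟨y, hy, hle⟩ := h x hx
    refine hle.trans (le_csSup ⟨(F.card : ℝ), ?_⟩ ⟨y, hy, rfl⟩)
    rintro v ⟨w, hw, rfl⟩
    unfold lagEvalN
    calc _ ≤ ∑ e ∈ F, (1:ℝ) := Finset.sum_le_sum fun e _ =>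
          Finset.prod_le_one (fun i _ => hw.1 i) (fun i _ => legal_le_one hw i)
      _ = _ := by simp

/-- The family `G1` in normalized coordinates: `r = k+3`, `t = n+k+5`. -/
def miss1 (n k : ℕ) : Finset (Finset ℕ) :=
  {Finset.Icc (n+3) (n+k+5), insert (n+2) (Finset.Icc (n+4) (n+k+5)),
    insert (n+2) (insert (n+3) (Finset.Icc (n+5) (n+k+5)))}

def miss2 (n k : ℕ) : Finset (Finset ℕ) :=
  {Finset.Icc (n+3) (n+k+5), insert (n+2) (Finset.Icc (n+4) (n+k+5)),
    insert (n+1) (Finset.Icc (n+4) (n+k+5))}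

lemma icc3 (n k : ℕ) : Finset.Icc (n+3) (n+k+5) = insert (n+3) (Finset.Icc (n+4) (n+k+5)) := by
  ext i; simp only [Finset.mem_Icc, Finset.mem_insert]; omega

lemma icc4 (n k : ℕ) : Finset.Icc (n+4) (n+k+5) = insert (n+4) (Finset.Icc (n+5) (n+k+5)) := by
  ext i; simp only [Finset.mem_Icc, Finset.mem_insert]; omega

lemma miss1_eval (n k : ℕ) (x : ℕ → ℝ) : lagEvalN (miss1 n k) x =
    (∏ i ∈ Finset.Icc (n+5) (n+k+5), x i) *
      (x (n+2) * x (n+3) + x (n+2) * x (n+4) + x (n+3) * x (n+4)) := by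
  unfold miss1 lagEvalN
  rw [icc3, icc4, Finset.sum_insert, Finset.sum_insert, Finset.sum_singleton]
  · rw [Finset.prod_insert, Finset.prod_insert, Finset.prod_insert, Finset.prod_insert,
      Finset.prod_insert, Finset.prod_insert]
    · ring
    all_goals simp
  · rw [Finset.mem_singleton]
    intro h
    have := Finset.ext_iff.1 h (n+3)
    simp at this
  · simp only [Finset.mem_insert, Finset.mem_singleton, not_or]
    constructor <;> intro h <;> have := Finset.ext_iff.1 h (n+2) <;> simp at this

lemma miss2_eval (n k : ℕ) (x : ℕ → ℝ) : lagEvalN (miss2 n k) x =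
    (∏ i ∈ Finset.Icc (n+5) (n+k+5), x i) *
      ((x (n+1) + x (n+2) + x (n+3)) * x (n+4)) := by
  unfold miss2 lagEvalN
  rw [icc3, icc4, Finset.sum_insert, Finset.sum_insert, Finset.sum_singleton]
  · rw [Finset.prod_insert, Finset.prod_insert, Finset.prod_insert, Finset.prod_insert,
      Finset.prod_insert, Finset.prod_insert]
    · ring
    all_goals simp
  · rw [Finset.mem_singleton]
    intro h
    have := Finset.ext_iff.1 h (n+1)
    simp at this
  · simp only [Finset.mem_insert, Finset.mem_singleton, not_or]
    constructor
    · intro h; have := Finset.ext_iff.1 h (n+2); simp at this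
    · intro h; have := Finset.ext_iff.1 h (n+1); simp at this

lemma miss1_sub (n k : ℕ) : miss1 n k ⊆ (Finset.Icc 1 (n+k+5)).powersetCard (k+3) := by
  intro e he
  simp only [miss1, Finset.mem_insert, Finset.mem_singleton] at he
  rw [Finset.mem_powersetCard]
  rcases he with rfl | rfl | rfl
  · refine ⟨fun i => by simp only [Finset.mem_Icc]; omega, by simp; omega⟩
  · refine ⟨fun i => by simp only [Finset.mem_insert, Finset.mem_Icc]; omega, ?_⟩
    rw [Finset.card_insert_of_notMem (by simp)]; simp; omega
  · refine ⟨fun i => by simp only [Finset.mem_insert, Finset.mem_Icc]; omega, ?_⟩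
    rw [Finset.card_insert_of_notMem (by simp), Finset.card_insert_of_notMem (by simp)]; simp; omega

lemma miss2_sub (n k : ℕ) : miss2 n k ⊆ (Finset.Icc 1 (n+k+5)).powersetCard (k+3) := by
  intro e he
  simp only [miss2, Finset.mem_insert, Finset.mem_singleton] at he
  rw [Finset.mem_powersetCard]
  rcases he with rfl | rfl | rfl
  · refine ⟨fun i => by simp only [Finset.mem_Icc]; omega, by simp; omega⟩
  · refine ⟨fun i => by simp only [Finset.mem_insert, Finset.mem_Icc]; omega, ?_⟩
    rw [Finset.card_insert_of_notMem (by simp)]; simp; omega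
  · refine ⟨fun i => by simp only [Finset.mem_insert, Finset.mem_Icc]; omega, ?_⟩
    rw [Finset.card_insert_of_notMem (by simp)]; simp; omega

/-- Key step: every weighting for `G1` is beaten by one for `G2`. -/
lemma g1_step (n k : ℕ) (x : ℕ → ℝ) (hx : IsLegalN x) : ∃ y, IsLegalN y ∧
    lagEvalN ((Finset.Icc 1 (n+k+5)).powersetCard (k+3) \ miss1 n k) x ≤
    lagEvalN ((Finset.Icc 1 (n+k+5)).powersetCard (k+3) \ miss2 n k) y := by
  set W := (Finset.Icc 1 (n+k+5)).filter (fun i => i ≤ n ∨ n + 5 ≤ i) with hW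
  have hT : Finset.Icc 1 (n+k+5) =
      insert (n+4) (insert (n+3) (insert (n+2) (insert (n+1) W))) := by
    ext i; simp only [hW, Finset.mem_Icc, Finset.mem_insert, Finset.mem_filter]; omega
  have ha : n+1 ∉ W := by simp [hW]
  have hb : n+2 ∉ insert (n+1) W := by simp [hW]
  have hc : n+3 ∉ insert (n+2) (insert (n+1) W) := by simp [hW]
  have hd : n+4 ∉ insert (n+3) (insert (n+2) (insert (n+1) W)) := by simp [hW]
  have hQP : ∏ i ∈ Finset.Icc (n+5) (n+k+5), x i ≤ lagEvalN (W.powersetCard (k+1)) x := by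
    apply Finset.single_le_sum (f := fun e => ∏ i ∈ e, x i)
      (fun e _ => Finset.prod_nonneg fun i _ => hx.1 i)
    rw [Finset.mem_powersetCard]
    refine ⟨fun i => by simp only [hW, Finset.mem_Icc, Finset.mem_filter]; omega, by simp; omega⟩
  obtain ⟨a', b', c', d', ha', hb', hc', hd', hsum, hle⟩ :=
    four_step (P0 := lagEvalN (W.powersetCard (k+3)) x) (P1 := lagEvalN (W.powersetCard (k+2)) x)
      (P2 := lagEvalN (W.powersetCard (k+1)) x) (lagEval_nonneg (W.powersetCard k) x hx.1)
      (lagPred_nonneg W k x hx.1) (Finset.prod_nonneg fun i _ => hx.1 i) hQP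
      (hx.1 (n+1)) (hx.1 (n+2)) (hx.1 (n+3)) (hx.1 (n+4))
  let y : ℕ → ℝ := fun i => if i = n+1 then a' else if i = n+2 then b' else if i = n+3 then c'
    else if i = n+4 then d' else x i
  have y1 : y (n+1) = a' := by simp [y]
  have y2 : y (n+2) = b' := by simp [y]
  have y3 : y (n+3) = c' := by simp [y]
  have y4 : y (n+4) = d' := by simp [y]
  have yo : ∀ i, (i ≤ n ∨ n+5 ≤ i) → x i = y i := by
    intro i hi
    simp only [y]
    rw [if_neg (by omega), if_neg (by omega), if_neg (by omega), if_neg (by omega)]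
  have yW : ∀ i ∈ W, x i = y i := fun i hi => yo i (Finset.mem_filter.1 hi).2
  refine ⟨y, ?_, ?_⟩
  · refine legal_of_modify {n+1, n+2, n+3, n+4} hx ?_ ?_ ?_
    · intro i; simp only [y]; split_ifs <;> first | assumption | exact hx.1 i
    · intro i hi
      simp only [Finset.mem_insert, Finset.mem_singleton] at hi
      exact (yo i (by omega)).symm
    · simp only [Finset.sum_insert, Finset.mem_insert, Finset.mem_singleton, Finset.sum_singleton,
        y1, y2, y3, y4, Nat.add_left_cancel_iff, OfNat.one_ne_ofNat, Nat.reduceEqDiff, or_self,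
        not_false_eq_true]
      linarith
  · rw [lag_sdiff _ _ (miss1_sub n k), lag_sdiff _ _ (miss2_sub n k), miss1_eval, miss2_eval, hT,
      lag_four W _ _ _ _ ha hb hc hd, lag_four W _ _ _ _ ha hb hc hd, y1, y2, y3, y4,
      ← lagEval_congr W _ x y yW, ← lagEval_congr W _ x y yW, ← lagEval_congr W _ x y yW,
      ← lagEval_congr W _ x y yW, ← lagPred_congr W _ x y yW,
      ← Finset.prod_congr rfl (fun i hi => yo i (Or.inr (Finset.mem_Icc.1 hi).1))]
    exact hle

lemma seg_le (t : ℕ) (x : ℕ → ℝ) (hx : ∀ i, 0 ≤ x i)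
    (hanti : ∀ i j, 1 ≤ i → i ≤ j → j ≤ t → x j ≤ x i) (k : ℕ) :
    ∀ A : Finset ℕ, A ⊆ Finset.Icc 1 t → A.card = k →
      ∏ i ∈ Finset.Ioc (t - k) t, x i ≤ ∏ i ∈ A, x i := by
  induction k with
  | zero => intro A _ hA; rw [Finset.card_eq_zero.1 hA]; simp
  | succ k ih =>
    intro A hA hc
    have hne : A.Nonempty := Finset.card_pos.1 (by omega)
    have hi := A.min'_mem hne
    set i := A.min' hne with hidef
    have hsub : A ⊆ Finset.Icc i t := fun j hj =>
      Finset.mem_Icc.2 ⟨A.min'_le j hj, (Finset.mem_Icc.1 (hA hj)).2⟩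
    have hcard := Finset.card_le_card hsub
    rw [Nat.card_Icc, hc] at hcard
    have hi1 := Finset.mem_Icc.1 (hA hi)
    have h1 := ih (A.erase i) ((Finset.erase_subset _ _).trans hA)
      (by rw [Finset.card_erase_of_mem hi]; omega)
    have e : Finset.Ioc (t - (k+1)) t = insert (t-k) (Finset.Ioc (t-k) t) := by
      ext j; simp only [Finset.mem_Ioc, Finset.mem_insert]; omega
    rw [e, Finset.prod_insert (by simp), ← Finset.mul_prod_erase A _ hi]
    exact mul_le_mul (hanti _ _ hi1.1 (by omega) (by omega)) h1
      (Finset.prod_nonneg fun _ _ => hx _) (hx _)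

lemma miss_min (n k : ℕ) (x : ℕ → ℝ) (hx : ∀ i, 0 ≤ x i)
    (hanti : ∀ i j, 1 ≤ i → i ≤ j → j ≤ n+k+5 → x j ≤ x i)
    (M : Finset (Finset ℕ)) (hM : M ⊆ (Finset.Icc 1 (n+k+5)).powersetCard (k+3))
    (hM3 : M.card = 3) :
    lagEvalN (miss1 n k) x ≤ lagEvalN M x ∨ lagEvalN (miss2 n k) x ≤ lagEvalN M x := by
  set Q := ∏ i ∈ Finset.Icc (n+5) (n+k+5), x i with hQ
  have hQ0 : 0 ≤ Q := Finset.prod_nonneg fun _ _ => hx _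
  have i3 : Finset.Ioc (n+k+5-(k+3)) (n+k+5) = Finset.Icc (n+3) (n+k+5) := by
    ext j; simp only [Finset.mem_Ioc, Finset.mem_Icc]; omega
  have i2 : Finset.Ioc (n+k+5-(k+2)) (n+k+5) = Finset.Icc (n+4) (n+k+5) := by
    ext j; simp only [Finset.mem_Ioc, Finset.mem_Icc]; omega
  have i1 : Finset.Ioc (n+k+5-(k+1)) (n+k+5) = Finset.Icc (n+5) (n+k+5) := by
    ext j; simp only [Finset.mem_Ioc, Finset.mem_Icc]; omega
  have p2 : ∏ i ∈ Finset.Icc (n+4) (n+k+5), x i = x (n+4) * Q := by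
    rw [icc4, Finset.prod_insert (by simp)]
  have p3 : ∏ i ∈ Finset.Icc (n+3) (n+k+5), x i = x (n+3) * (x (n+4) * Q) := by
    rw [icc3, Finset.prod_insert (by simp), p2]
  have f0 : ∀ A ∈ M, x (n+3) * (x (n+4) * Q) ≤ ∏ i ∈ A, x i := by
    intro A hA
    obtain ⟨h1, h2⟩ := Finset.mem_powersetCard.1 (hM hA)
    rw [← p3, ← i3]
    exact seg_le _ x hx hanti _ A h1 h2
  have low : ∀ A ∈ M, ∀ j, 1 ≤ j → j ≤ n+2 → (∃ i ∈ A, i ≤ j) →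
      x j * (x (n+4) * Q) ≤ ∏ i ∈ A, x i := by
    rintro A hA j hj hj2 ⟨i, hi, hij⟩
    obtain ⟨h1, h2⟩ := Finset.mem_powersetCard.1 (hM hA)
    have := seg_le _ x hx hanti (k+2) (A.erase i) ((Finset.erase_subset _ _).trans h1)
      (by rw [Finset.card_erase_of_mem hi]; omega)
    rw [i2, p2] at this
    rw [← Finset.mul_prod_erase A _ hi]
    exact mul_le_mul (hanti _ _ (Finset.mem_Icc.1 (h1 hi)).1 hij (by omega)) this
      (mul_nonneg (hx _) hQ0) (hx _)
  have f1 : ∀ A ∈ M, A ≠ Finset.Icc (n+3) (n+k+5) →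
      x (n+2) * (x (n+4) * Q) ≤ ∏ i ∈ A, x i := by
    intro A hA hne
    obtain ⟨h1, h2⟩ := Finset.mem_powersetCard.1 (hM hA)
    refine low A hA (n+2) (by omega) le_rfl ?_
    by_contra h
    push Not at h
    apply hne
    apply Finset.eq_of_subset_of_card_le
    · intro i hi
      have := h i hi
      have := Finset.mem_Icc.1 (h1 hi)
      exact Finset.mem_Icc.2 ⟨by omega, by omega⟩
    · rw [h2]; simp; omega
  have f2 : ∀ A ∈ M, A ≠ Finset.Icc (n+3) (n+k+5) →
      A ≠ insert (n+2) (Finset.Icc (n+4) (n+k+5)) →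
      x (n+1) * (x (n+4) * Q) ≤ ∏ i ∈ A, x i ∨ x (n+2) * (x (n+3) * Q) ≤ ∏ i ∈ A, x i := by
    intro A hA hne hne'
    obtain ⟨h1, h2⟩ := Finset.mem_powersetCard.1 (hM hA)
    by_cases h : ∃ i ∈ A, i ≤ n+1
    · exact Or.inl (low A hA (n+1) (by omega) (by omega) h)
    right
    push Not at h
    have hb : n+2 ∈ A := by
      by_contra hb
      apply hne
      apply Finset.eq_of_subset_of_card_le
      · intro i hi
        have := h i hi
        have := Finset.mem_Icc.1 (h1 hi)
        have : i ≠ n+2 := fun e => hb (e ▸ hi)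
        exact Finset.mem_Icc.2 ⟨by omega, by omega⟩
      · rw [h2]; simp; omega
    have hc : n+3 ∈ A := by
      by_contra hb
      apply hne'
      apply Finset.eq_of_subset_of_card_le
      · intro i hi
        have := h i hi
        have := Finset.mem_Icc.1 (h1 hi)
        have : i ≠ n+3 := fun e => hb (e ▸ hi)
        simp only [Finset.mem_insert, Finset.mem_Icc]; omega
      · rw [h2, Finset.card_insert_of_notMem (by simp)]; simp; omega
    have hc' : n+3 ∈ A.erase (n+2) := Finset.mem_erase.2 ⟨by omega, hc⟩
    have := seg_le _ x hx hanti (k+1) ((A.erase (n+2)).erase (n+3))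
      (((Finset.erase_subset _ _).trans (Finset.erase_subset _ _)).trans h1)
      (by rw [Finset.card_erase_of_mem hc', Finset.card_erase_of_mem hb]; omega)
    rw [i1] at this
    rw [← Finset.mul_prod_erase A _ hb, ← Finset.mul_prod_erase _ _ hc']
    exact mul_le_mul_of_nonneg_left (mul_le_mul_of_nonneg_left this (hx _)) (hx _)
  rw [miss1_eval, miss2_eval, ← hQ]
  -- choose the elements
  obtain ⟨Z, hZ, hZ'⟩ : ∃ Z ∈ M, Z ∉ ({Finset.Icc (n+3) (n+k+5),
      insert (n+2) (Finset.Icc (n+4) (n+k+5))} : Finset (Finset ℕ)) := by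
    apply Finset.exists_mem_notMem_of_card_lt_card
    rw [hM3]; exact lt_of_le_of_lt Finset.card_le_two (by norm_num)
  have hMZ : (M.erase Z).card = 2 := by rw [Finset.card_erase_of_mem hZ]; omega
  obtain ⟨Y, hY, hY'⟩ : ∃ Y ∈ M.erase Z, Y ∉ ({Finset.Icc (n+3) (n+k+5)} : Finset (Finset ℕ)) := by
    apply Finset.exists_mem_notMem_of_card_lt_card
    rw [hMZ]; simp
  have hMY : ((M.erase Z).erase Y).card = 1 := by rw [Finset.card_erase_of_mem hY]; omega
  obtain ⟨X, hX⟩ := Finset.card_eq_one.1 hMY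
  have hXM : X ∈ M := by
    have : X ∈ (M.erase Z).erase Y := by rw [hX]; simp
    exact Finset.mem_of_mem_erase (Finset.mem_of_mem_erase this)
  have hsum : lagEvalN M x = ∏ i ∈ Z, x i + (∏ i ∈ Y, x i + ∏ i ∈ X, x i) := by
    unfold lagEvalN
    rw [← Finset.add_sum_erase M _ hZ, ← Finset.add_sum_erase _ _ hY, hX, Finset.sum_singleton]
  simp only [Finset.mem_insert, Finset.mem_singleton, not_or] at hZ' hY'
  have g0 := f0 X hXM
  have g1 := f1 Y (Finset.mem_of_mem_erase hY) hY'
  rw [hsum]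
  rcases f2 Z hZ hZ'.1 hZ'.2 with g2 | g2
  · right; nlinarith
  · left; nlinarith

/-- Sorting a weighting on `Icc 1 t`. -/
lemma exists_sort (t : ℕ) (x : ℕ → ℝ) : ∃ σ : Equiv.Perm ℕ,
    (∀ i, i ∉ Finset.Icc 1 t → σ i = i) ∧
    ∀ i j, 1 ≤ i → i ≤ j → j ≤ t → x (σ j) ≤ x (σ i) := by
  let e : Fin t ≃ {i : ℕ // i ∈ Finset.Icc 1 t} :=
    { toFun := fun i => ⟨i.1 + 1, by have := i.2; simp only [Finset.mem_Icc]; omega⟩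
      invFun := fun i => ⟨i.1 - 1, by have := Finset.mem_Icc.1 i.2; omega⟩
      left_inv := fun i => by ext; simp
      right_inv := fun i => by
        have := Finset.mem_Icc.1 i.2
        ext; simp only; omega }
  let g : Fin t → ℝ := fun i => - x (i.1 + 1)
  let τ : Equiv.Perm (Fin t) := Tuple.sort g
  have hτ : Monotone (g ∘ τ) := Tuple.monotone_sort g
  refine ⟨τ.extendDomain e, ?_, ?_⟩
  · intro i hi
    exact Equiv.Perm.extendDomain_apply_not_subtype _ _ hi
  · intro i j hi hij hj
    have key : ∀ m (h1 : 1 ≤ m) (h2 : m ≤ t),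
        τ.extendDomain e m = (τ ⟨m-1, by omega⟩).1 + 1 := by
      intro m h1 h2
      have := Equiv.Perm.extendDomain_apply_image τ e ⟨m-1, by omega⟩
      have h3 : ((e ⟨m-1, by omega⟩ : {i : ℕ // i ∈ Finset.Icc 1 t}) : ℕ) = m := by
        simp only [e, Equiv.coe_fn_mk]; omega
      rw [h3] at this
      rw [this]; rfl
    rw [key i hi (by omega), key j (by omega) hj]
    have := hτ (show (⟨i-1, by omega⟩ : Fin t) ≤ ⟨j-1, by omega⟩ by
      simp only [Fin.mk_le_mk]; omega)
    simp only [Function.comp, g] at this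
    linarith

lemma main_step (n k : ℕ) (E : Finset (Finset ℕ))
    (hE : E ⊆ (Finset.Icc 1 (n+k+5)).powersetCard (k+3))
    (hcard : E.card = (n+k+5).choose (k+3) - 3) (x : ℕ → ℝ) (hx : IsLegalN x) :
    ∃ y, IsLegalN y ∧ lagEvalN E x ≤
      lagEvalN ((Finset.Icc 1 (n+k+5)).powersetCard (k+3) \ miss2 n k) y := by
  obtain ⟨σ, hσ, hanti⟩ := exists_sort (n+k+5) x
  set T := Finset.Icc 1 (n+k+5) with hT
  set K := T.powersetCard (k+3) with hK
  have hσT : ∀ i, σ i ∈ T ↔ i ∈ T := by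
    intro i
    constructor
    · intro h
      by_contra hi
      rw [hσ i hi] at h; exact hi h
    · intro h
      by_contra hi
      have := σ.injective (hσ _ hi)
      rw [this] at hi; exact hi h
  have hKcard : K.card = (n+k+5).choose (k+3) := by
    rw [hK, Finset.card_powersetCard, hT]; simp
  have h3 : 3 ≤ (n+k+5).choose (k+3) := by
    have h := Finset.card_le_card (miss2_sub n k)
    have : (miss2 n k).card = 3 := by
      rw [Finset.card_eq_three]
      refine ⟨_, _, _, ?_, ?_, ?_, rfl⟩
      · intro h; have := Finset.ext_iff.1 h (n+2); simp at this
      · intro h; have := Finset.ext_iff.1 h (n+1); simp at this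
      · intro h; have := Finset.ext_iff.1 h (n+1); simp at this
    rw [this, ← hK, hKcard] at h
    exact h
  -- relabelled missing family
  let φ : Finset ℕ ↪ Finset ℕ := (Finset.mapEmbedding σ.symm.toEmbedding).toEmbedding
  have hev : ∀ F : Finset (Finset ℕ), lagEvalN (F.map φ) (x ∘ σ) = lagEvalN F x := by
    intro F
    unfold lagEvalN
    rw [Finset.sum_map]
    apply Finset.sum_congr rfl
    intro e _
    simp [φ, Finset.mapEmbedding_apply, Finset.prod_map]
  have hφK : ∀ F ⊆ K, F.map φ ⊆ K := by
    intro F hF e he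
    obtain ⟨f, hf, rfl⟩ := Finset.mem_map.1 he
    obtain ⟨h1, h2⟩ := Finset.mem_powersetCard.1 (hF hf)
    refine Finset.mem_powersetCard.2 ⟨?_, by simpa [φ, Finset.mapEmbedding_apply] using h2⟩
    intro i hi
    obtain ⟨j, hj, rfl⟩ := Finset.mem_map.1 (show i ∈ f.map σ.symm.toEmbedding from hi)
    have := h1 hj
    rw [← hσT]
    simpa using this
  have hKK : K.map φ = K := Finset.eq_of_subset_of_card_le (hφK K (Finset.Subset.refl _)) (by simp)
  have hlegal : IsLegalN (x ∘ σ) := by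
    refine legal_of_modify T hx (fun i => hx.1 _) (fun i hi => by simp [hσ i hi]) ?_
    exact Finset.sum_equiv σ (fun i => (hσT i).symm) (fun i _ => rfl)
  have hMsub : K \ E ⊆ K := Finset.sdiff_subset
  have hMc : ((K \ E).map φ).card = 3 := by
    rw [Finset.card_map, Finset.card_sdiff_of_subset hE, hKcard, hcard]; omega
  have hval : lagEvalN E x = lagEvalN K (x ∘ σ) - lagEvalN ((K \ E).map φ) (x ∘ σ) := by
    have h1 := hev K
    rw [hKK] at h1
    rw [h1, hev, lag_sdiff K E hE]; ring
  rcases miss_min n k (x ∘ σ) hlegal.1 hanti _ (hφK _ hMsub) hMc with h | h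
  · obtain ⟨y, hy, hle⟩ := g1_step n k _ hlegal
    refine ⟨y, hy, le_trans ?_ hle⟩
    rw [lag_sdiff _ _ (miss1_sub n k), hval]
    linarith
  · refine ⟨_, hlegal, ?_⟩
    rw [lag_sdiff _ _ (miss2_sub n k), hval]
    linarith

/-- Theorem 1.7: for `m = C(t,r) − 3`, the colex-first `r`-graph `G2` on `[t]` has the
largest Lagrangian among all `r`-graphs on `t` vertices with `m` edges; in particular
`λ(G1) ≤ λ(G2)` for the other left-compressed candidate `G1`. -/
theorem colex_first_max_choose_sub_three {t r : ℕ} (hr : 3 ≤ r) (ht : r + 2 ≤ t) :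
    (∀ E : Finset (Finset ℕ), E ⊆ (Finset.Icc 1 t).powersetCard r →
      E.card = t.choose r - 3 →
      lagrangianN E ≤
        lagrangianN ((Finset.Icc 1 t).powersetCard r \
          {Finset.Icc (t - r + 1) t,
           insert (t - r) (Finset.Icc (t - r + 2) t),
           insert (t - r - 1) (Finset.Icc (t - r + 2) t)})) ∧
    lagrangianN ((Finset.Icc 1 t).powersetCard r \
        {Finset.Icc (t - r + 1) t,
         insert (t - r) (Finset.Icc (t - r + 2) t),
         insert (t - r) (insert (t - r + 1) (Finset.Icc (t - r + 3) t))}) ≤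
      lagrangianN ((Finset.Icc 1 t).powersetCard r \
        {Finset.Icc (t - r + 1) t,
         insert (t - r) (Finset.Icc (t - r + 2) t),
         insert (t - r - 1) (Finset.Icc (t - r + 2) t)}) := by
  obtain ⟨k, rfl⟩ : ∃ k, r = k + 3 := ⟨r - 3, by omega⟩
  obtain ⟨n, rfl⟩ : ∃ n, t = n + k + 5 := ⟨t - k - 5, by omega⟩
  have e1 : n + k + 5 - (k + 3) = n + 2 := by omega
  have e2 : n + 2 - 1 = n + 1 := by omega
  rw [e1, e2]
  refine ⟨fun E hE hcard => ?_, ?_⟩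
  · exact lagrangian_le_of _ _ (main_step n k E hE hcard)
  · exact lagrangian_le_of _ _ (g1_step n k)
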